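/- Fix an integer i ≥ 1 and an integer g with g > 5i + 76. Then the dimension over ℚ of the weighted-degree-i homogeneous component S(g)_i of the graded ring S(g) equals: 2 if i = 1; 5 if i = 2; 6 if i = 3; 7 if i = 4; 4 if i = 5; 3 if i = 6; and 2 if i ≥ 7. (This is the algebraic content of the dimension formulas for the stable Chow groups of the degree-5 Hurwitz space in the paper's main theorem.) -/

import Mathlib

open MvPolynomial

noncomputable section

/-- The polynomial ring `ℚ[a₁, a₂′, a₂, c₂]`. -/
abbrev P4 : Type := MvPolynomial (Fin 4) ℚ

/-- Weights: `a₁` and `a₂′` have weight 1; `a₂` and `c₂` have weight 2. -/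
def wt : Fin 4 → ℕ := ![1, 1, 2, 2]

def a1 : P4 := X 0
def a2' : P4 := X 1
def a2 : P4 := X 2
def c2 : P4 := X 3

/-- The relation `r₁`. -/
def r1 (g : ℤ) : P4 :=
  C (1064*(g:ℚ) + 3610) * a1^3 - C (1074 : ℚ) * (a1^2 * a2')
    - C (2148*(g:ℚ) + 7272) * (a1 * a2) + C (2160 : ℚ) * (a2 * a2')
    - C (1064*(g:ℚ)^3 + 10830*(g:ℚ)^2 + 36680*(g:ℚ) + 41360) * (a1 * c2)
    + C (1074*(g:ℚ)^2 + 7272*(g:ℚ) + 12288) * (a2' * c2)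

/-- The relation `r₂`. -/
def r2 (g : ℤ) : P4 :=
  - C (6412*(g:ℚ) + 21255) * a1^3 + C (6207 : ℚ) * (a1^2 * a2')
    + C (12414*(g:ℚ) + 40896) * (a1 * a2) - C (11880 : ℚ) * (a2 * a2')
    + C (6412*(g:ℚ)^3 + 63765*(g:ℚ)^2 + 211540*(g:ℚ) + 234480) * (a1 * c2)
    - C (6207*(g:ℚ)^2 + 40896*(g:ℚ) + 68184) * (a2' * c2)

/-- The relation `r₃`. -/
def r3 (g : ℤ) : P4 :=
  - C (22845*(g:ℚ) + 67763) * a1^4 + C (18141 : ℚ) * (a1^3 * a2')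
    + C (54423*(g:ℚ) + 146550) * (a1^2 * a2) - C (35640 : ℚ) * (a1 * a2 * a2')
    + C (45690*(g:ℚ)^3 + 406578*(g:ℚ)^2 + 1184220*(g:ℚ) + 1123060) * (a1^2 * c2)
    - C (54423*(g:ℚ)^2 + 293100*(g:ℚ) + 372648) * (a1 * a2' * c2)
    + C (17820*(g:ℚ) + 24840) * (a2'^2 * c2)
    - C (17820*(g:ℚ) + 24840) * (a2^2)
    - C (18141*(g:ℚ)^3 + 146550*(g:ℚ)^2 + 372648*(g:ℚ) + 283824) * (a2 * c2)
    - C (4569*(g:ℚ)^5 + 67763*(g:ℚ)^4 + 394740*(g:ℚ)^3 + 1123060*(g:ℚ)^2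
        + 1546176*(g:ℚ) + 810432) * (c2^2)

/-- The relation `r₄`. -/
def r4 (g : ℤ) : P4 :=
  C (133 : ℚ) * a1^4 - C (537 : ℚ) * (a1^2 * a2)
    - C (798*(g:ℚ)^2 + 5415*(g:ℚ) + 9170) * (a1^2 * c2)
    + C (1074*(g:ℚ) + 3636) * (a1 * a2' * c2)
    - C (540 : ℚ) * (a2'^2 * c2) + C (540 : ℚ) * (a2^2)
    + C (537*(g:ℚ)^2 + 3636*(g:ℚ) + 6144) * (a2 * c2)
    + C (133*(g:ℚ)^4 + 1805*(g:ℚ)^3 + 9170*(g:ℚ)^2 + 20680*(g:ℚ) + 17472) * (c2^2)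

/-- The relation `r₅`. -/
def r5 (g : ℤ) : P4 :=
  - C (18545*(g:ℚ) + 68407) * a1^4 + C (15261 : ℚ) * (a1^3 * a2')
    + C (45783*(g:ℚ) + 175866) * (a1^2 * a2) - C (31320 : ℚ) * (a1 * a2 * a2')
    + C (37090*(g:ℚ)^3 + 410442*(g:ℚ)^2 + 1499460*(g:ℚ) + 1811300) * (a1^2 * c2)
    - C (45783*(g:ℚ)^2 + 351732*(g:ℚ) + 662976) * (a1 * a2' * c2)
    + C (15660*(g:ℚ) + 72360) * (a2'^2 * c2)
    - C (15660*(g:ℚ) + 72360) * (a2^2)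
    - C (15261*(g:ℚ)^3 + 175866*(g:ℚ)^2 + 662976*(g:ℚ) + 822096) * (a2 * c2)
    - C (3709*(g:ℚ)^5 + 68407*(g:ℚ)^4 + 499820*(g:ℚ)^3 + 1811300*(g:ℚ)^2
        + 3260256*(g:ℚ) + 2334528) * (c2^2)

/-- The ideal `J(g) = (r₁, r₂, r₃, r₄, r₅)`. -/
def Jg (g : ℤ) : Ideal P4 := Ideal.span {r1 g, r2 g, r3 g, r4 g, r5 g}

/-- The quotient map `P → S(g) = P/J(g)`, as a `ℚ`-linear map. -/
def Smk (g : ℤ) : P4 →ₗ[ℚ] P4 ⧸ Jg g := (Ideal.Quotient.mkₐ ℚ (Jg g)).toLinearMap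

/-- `S(g)_i`: the image in `S(g)` of the weighted-degree-`i` homogeneous polynomials. -/
def SComp (g : ℤ) (i : ℕ) : Submodule ℚ (P4 ⧸ Jg g) :=
  (weightedHomogeneousSubmodule ℚ wt i).map (Smk g)

section

variable {A : Type*} [CommRing A] [Algebra ℚ A] {q : ℚ} {x y z w : A}

/-- The relations `r₁, …, r₅` with `g = q`, imposed on four elements of a `ℚ`-algebra. -/
structure Relations (q : ℚ) (x y z w : A) : Prop where
  rel1 :
    (1064 * q + 3610) • (x ^ 3) + (-1074 : ℚ) • (x ^ 2 * y) + (-2148 * q - 7272) • (x * z)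
    + (2160 : ℚ) • (y * z) + (-1064 * q ^ 3 - 10830 * q ^ 2 - 36680 * q - 41360) • (x * w)
    + (1074 * q ^ 2 + 7272 * q + 12288) • (y * w) = 0
  rel2 :
    (-6412 * q - 21255) • (x ^ 3) + (6207 : ℚ) • (x ^ 2 * y) + (12414 * q + 40896) • (x * z)
    + (-11880 : ℚ) • (y * z) + (6412 * q ^ 3 + 63765 * q ^ 2 + 211540 * q + 234480) • (x * w)
    + (-6207 * q ^ 2 - 40896 * q - 68184) • (y * w) = 0
  rel3 :
    (-22845 * q - 67763) • (x ^ 4) + (18141 : ℚ) • (x ^ 3 * y)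
    + (54423 * q + 146550) • (x ^ 2 * z) + (-35640 : ℚ) • (x * y * z)
    + (45690 * q ^ 3 + 406578 * q ^ 2 + 1184220 * q + 1123060) • (x ^ 2 * w)
    + (-54423 * q ^ 2 - 293100 * q - 372648) • (x * y * w) + (17820 * q + 24840) • (y ^ 2 * w)
    + (-17820 * q - 24840) • (z ^ 2)
    + (-18141 * q ^ 3 - 146550 * q ^ 2 - 372648 * q - 283824) • (z * w)
    + (-4569 * q ^ 5 - 67763 * q ^ 4 - 394740 * q ^ 3 - 1123060 * q ^ 2 - 1546176 * q
      - 810432) • (w ^ 2) = 0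
  rel4 :
    (133 : ℚ) • (x ^ 4) + (-537 : ℚ) • (x ^ 2 * z)
    + (-798 * q ^ 2 - 5415 * q - 9170) • (x ^ 2 * w) + (1074 * q + 3636) • (x * y * w)
    + (-540 : ℚ) • (y ^ 2 * w) + (540 : ℚ) • (z ^ 2) + (537 * q ^ 2 + 3636 * q + 6144) • (z * w)
    + (133 * q ^ 4 + 1805 * q ^ 3 + 9170 * q ^ 2 + 20680 * q + 17472) • (w ^ 2) = 0
  rel5 :
    (-18545 * q - 68407) • (x ^ 4) + (15261 : ℚ) • (x ^ 3 * y)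
    + (45783 * q + 175866) • (x ^ 2 * z) + (-31320 : ℚ) • (x * y * z)
    + (37090 * q ^ 3 + 410442 * q ^ 2 + 1499460 * q + 1811300) • (x ^ 2 * w)
    + (-45783 * q ^ 2 - 351732 * q - 662976) • (x * y * w) + (15660 * q + 72360) • (y ^ 2 * w)
    + (-15660 * q - 72360) • (z ^ 2)
    + (-15261 * q ^ 3 - 175866 * q ^ 2 - 662976 * q - 822096) • (z * w)
    + (-3709 * q ^ 5 - 68407 * q ^ 4 - 499820 * q ^ 3 - 1811300 * q ^ 2 - 3260256 * q
      - 2334528) • (w ^ 2) = 0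

theorem Relations.rel_yz (h : Relations q x y z w) :
    (5400 : ℚ) • (y * z) =
      (-10125 * q - 25350) • (y * w)
    + (-2352 * q ^ 3 - 10515 * q ^ 2 + 3990 * q + 40750) • (x * w) + (10125 : ℚ) • (x * z)
    + (2352 * q + 3505) • (x ^ 3) := by
  refine smul_right_injective A (show (40 : ℚ) ≠ 0 by positivity) ?_
  dsimp only
  linear_combination (norm := algebra)
    (2069 : ℚ) • h.rel1 + (358 : ℚ) • h.rel2

theorem Relations.rel_xxy (h : Relations q x y z w) :
    (15 : ℚ) • (x ^ 2 * y) =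
      (15 * q ^ 2 + 45 * q + 30) • (y * w) + (-28 * q ^ 3 - 210 * q ^ 2 - 490 * q - 350) • (x * w)
    + (-30 * q - 45) • (x * z) + (28 * q + 70) • (x ^ 3) := by
  refine smul_right_injective A (show (40 : ℚ) ≠ 0 by positivity) ?_
  dsimp only
  linear_combination (norm := algebra)
    (11 : ℚ) • h.rel1 + (2 : ℚ) • h.rel2

theorem Relations.rel_xyw (h : Relations q x y z w) (hq : 0 < q) :
    (75 * (2 * q + 3)) • (x * y * w) =
      (-28 * q ^ 4 - 294 * q ^ 3 - 1092 * q ^ 2 - 1666 * q - 840) • (w ^ 2)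
    + (-75 * q ^ 2 - 225 * q - 150) • (z * w) + (140 * q ^ 2 + 770 * q + 1050) • (x ^ 2 * w)
    + (75 : ℚ) • (x ^ 2 * z) := by
  refine smul_right_injective A (show 20 * (q + 2) * (25 * q + 46) ≠ 0 by positivity) ?_
  dsimp only
  linear_combination (norm := algebra)
    (-5353 * q - 8445) • (x * h.rel1) + (-197 * q - 380) • h.rel3
    + (-10706 * q ^ 2 - 45382 * q - 37580) • h.rel4 + (-145 * q - 150) • h.rel5
    + (2500 * q + 7520) • (x * h.rel_xxy)

theorem Relations.rel_yyw (h : Relations q x y z w) (hq : 0 < q) :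
    (13500 * (2 * q + 3)) • (y ^ 2 * w) =
      (-4704 * q ^ 5 - 51598 * q ^ 4 - 194619 * q ^ 3 - 252047 * q ^ 2 + 80748 * q
        + 292320) • (w ^ 2)
    + (50625 * q ^ 2 + 253500 * q + 279000) • (z * w) + (27000 * q + 40500) • (z ^ 2)
    + (23520 * q ^ 3 + 187890 * q ^ 2 + 557565 * q + 634725) • (x ^ 2 * w)
    + (50625 : ℚ) • (x ^ 2 * z) := by
  refine smul_right_injective A (show 4 * (29 * q + 30) ≠ 0 by positivity) ?_
  dsimp only
  linear_combination (norm := algebra)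
    (-58520 * q - 87780) • (x * h.rel1) + (9310 * q + 13965) • (x * h.rel2)
    + (-6650 * q - 9975) • h.rel3 + (-225250 * q ^ 2 - 649775 * q - 467850) • h.rel4
    + (4288 * q ^ 2 + 74492 * q + 65640) • (h.rel_xyw hq)

theorem Relations.rel_xxxx (h : Relations q x y z w) (hq : 0 < q) :
    (5 : ℚ) • (x ^ 4) =
      (-q ^ 4 - 8 * q ^ 3 - 19 * q ^ 2 - 12 * q) • (w ^ 2)
    + (10 * q ^ 2 + 40 * q + 25) • (x ^ 2 * w) := by
  refine smul_right_injective A (show 8 * (197 * q + 380) ≠ 0 by positivity) ?_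
  dsimp only
  linear_combination (norm := algebra)
    (725 : ℚ) • (x * h.rel1) + (1450 * q + 6700) • h.rel4 + (50 : ℚ) • h.rel5
    + (1040 : ℚ) • (x * h.rel_xxy) + (-208 * q - 400) • (h.rel_xyw hq)

theorem Relations.rel_yww (h : Relations q x y z w) (hq : 0 < q) :
    (15 * (3 * q + 4)) • (y * w ^ 2) =
      (56 * q ^ 2 + 364 * q + 588) • (x * w ^ 2) + (75 : ℚ) • (x * z * w) := by
  refine smul_right_injective A (show 4 * (q + 1) * (2 * q + 5) * (2 * q + 3) ≠ 0 by positivity) ?_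
  dsimp only
  linear_combination (norm := algebra)
    (35 * q + 35) • ((x ^ 2) * h.rel_yz)
    + (-35 * q ^ 3 - 140 * q ^ 2 - 175 * q - 70) • (w * h.rel_yz)
    + (-2940 * q - 2930) • ((x ^ 2) * h.rel_xxy)
    + (2940 * q ^ 3 - 155 * q ^ 2 - 27085 * q - 23990) • (w * h.rel_xxy)
    + (-6300 * q - 6300) • (z * h.rel_xxy) + (1260 * q + 1260) • (y * h.rel_xyw hq)
    + (1176 * q ^ 2 + 5296 * q + 4122) • (x * h.rel_xyw hq) + (-7 * q - 7) • (x * h.rel_yyw hq)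
    + (8820 * q + 8790) • (y * h.rel_xxxx hq) + (-16569 * q - 16485) • (x * h.rel_xxxx hq)

theorem Relations.rel_xzz (h : Relations q x y z w) (hq : 0 < q) :
    (13500 * (3 * q + 4)) • (x * z ^ 2) =
      (2352 * q ^ 5 - 11790 * q ^ 4 - 291713 * q ^ 3 - 1351812 * q ^ 2 - 2450941 * q
        - 1521240) • (x * w ^ 2)
    + (-25200 * q ^ 3 - 239625 * q ^ 2 - 706950 * q - 580875) • (x * z * w) := by
  refine smul_right_injective A (show 28 * (q + 1) * (2 * q + 5) * (2 * q + 3) ≠ 0 by positivity) ?_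
  dsimp only
  linear_combination (norm := algebra)
    (105840 * q ^ 3 + 476055 * q ^ 2 + 693855 * q + 329700) • ((x ^ 2) * h.rel_xxy)
    + (-105840 * q ^ 5 - 795195 * q ^ 4 - 2064330 * q ^ 3 - 2035185 * q ^ 2 - 395610 * q
      + 264600) • (w * h.rel_xxy)
    + (75600 * q ^ 3 + 365400 * q ^ 2 + 541800 * q + 252000) • (z * h.rel_xxy)
    + (15120 * q ^ 3 + 73080 * q ^ 2 + 108360 * q + 50400) • (y * h.rel_xyw hq)
    + (14112 * q ^ 4 + 103650 * q ^ 3 + 293913 * q ^ 2 + 354783 * q + 151620) • (x * h.rel_xyw hq)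
    + (-84 * q ^ 3 - 406 * q ^ 2 - 602 * q - 280) • (x * h.rel_yyw hq)
    + (-317520 * q ^ 3 - 1428165 * q ^ 2 - 2081565 * q - 989100) • (y * h.rel_xxxx hq)
    + (592704 * q ^ 4 + 4147668 * q ^ 3 + 10550358 * q ^ 2 + 11560290 * q
      + 4615800) • (x * h.rel_xxxx hq)
    + (-37632 * q ^ 6 - 376800 * q ^ 5 - 1529040 * q ^ 4 - 3226920 * q ^ 3 - 3751788 * q ^ 2
      - 2288040 * q - 573300) • (h.rel_yww hq)

theorem Relations.rel_xxxz (h : Relations q x y z w) (hq : 0 < q) :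
    (75 * (3 * q + 4)) • (x ^ 3 * z) =
      (56 * q ^ 5 + 448 * q ^ 4 + 1162 * q ^ 3 + 1064 * q ^ 2 + 294 * q) • (x * w ^ 2)
    + (75 * q ^ 3 + 450 * q ^ 2 + 600 * q + 150) • (x * z * w) := by
  refine smul_right_injective A (show (q + 1) * (2 * q + 3) ≠ 0 by positivity) ?_
  dsimp only
  linear_combination (norm := algebra)
    (15 * q ^ 2 + 20 * q) • ((x ^ 2) * h.rel_xxy)
    + (-15 * q ^ 4 - 35 * q ^ 3 + 115 * q ^ 2 + 315 * q + 180) • (w * h.rel_xxy)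
    + (-6 * q ^ 2 - 17 * q - 12) • (x * h.rel_xyw hq)
    + (-45 * q ^ 2 - 60 * q) • (y * h.rel_xxxx hq)
    + (84 * q ^ 3 + 322 * q ^ 2 + 280 * q) • (x * h.rel_xxxx hq)
    + (-4 * q ^ 5 - 12 * q ^ 4 + 39 * q ^ 3 + 182 * q ^ 2 + 225 * q + 90) • (h.rel_yww hq)

theorem Relations.rel_xxxw (h : Relations q x y z w) (hq : 0 < q) :
    (5 : ℚ) • (x ^ 3 * w) =
      (3 * q ^ 2 + 12 * q + 4) • (x * w ^ 2) := by
  refine smul_right_injective A (show 14 * q * (2 * q + 5) * (3 * q + 4) ≠ 0 by positivity) ?_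
  dsimp only
  linear_combination (norm := algebra)
    (-30 * q ^ 2 - 85 * q - 60) • (w * h.rel_xxy) + (3 * q + 4) • (x * h.rel_xyw hq)
    + (-10 * q ^ 3 - 45 * q ^ 2 - 65 * q - 30) • (h.rel_yww hq) + h.rel_xxxz hq

theorem Relations.rel_xxww (h : Relations q x y z w) (hq : 0 < q) :
    (7 : ℚ) • (x ^ 2 * w ^ 2) =
      (q ^ 2 + 4 * q) • (w ^ 3) := by
  refine smul_right_injective A (show (q + 3) * (q + 1) ≠ 0 by positivity) ?_
  dsimp only
  linear_combination (norm := algebra)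
    (-1 : ℚ) • (w * h.rel_xxxx hq) + x * h.rel_xxxw hq

theorem Relations.rel_xxzw (h : Relations q x y z w) (hq : 0 < q) :
    (75 : ℚ) • (x ^ 2 * z * w) =
      (-2 * q ^ 4 - 31 * q ^ 3 - 148 * q ^ 2 - 224 * q) • (w ^ 3) := by
  refine smul_right_injective A (show 2 * (q + 3) * (2 * q + 1) ≠ 0 by positivity) ?_
  dsimp only
  linear_combination (norm := algebra)
    (15 * q + 20) • ((x * w) * h.rel_xxy) + (2 * q ^ 2 + 3 * q + 6) • (x * h.rel_yww hq)
    + (-45 * q - 60) • (y * h.rel_xxxw hq) + (84 * q ^ 2 + 322 * q + 280) • (x * h.rel_xxxw hq)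
    + (-8 * q ^ 4 - 120 * q ^ 3 - 558 * q ^ 2 - 922 * q - 336) • (h.rel_xxww hq)

theorem Relations.rel_zww (h : Relations q x y z w) (hq : 0 < q) :
    (5 : ℚ) • (z * w ^ 2) =
      (-2 * q ^ 2 - 15 * q - 28) • (w ^ 3) := by
  refine smul_right_injective A (show 3 * (q + 4) * (q + 3) * (q + 1) * q * (3 * q
      + 4) ≠ 0 by positivity) ?_
  dsimp only
  linear_combination (norm := algebra)
    (45 * q + 60) • (z * h.rel_xxxx hq) + (-1 : ℚ) • (x * h.rel_xxxz hq)
    + (-8 * q ^ 5 - 64 * q ^ 4 - 166 * q ^ 3 - 152 * q ^ 2 - 42 * q) • (h.rel_xxww hq)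
    + (5 * q ^ 3 + 26 * q ^ 2 + 39 * q + 18) • (h.rel_xxzw hq)

theorem Relations.rel_zzw (h : Relations q x y z w) (hq : 0 < q) :
    (47250 : ℚ) • (z ^ 2 * w) =
      (8232 * q ^ 4 + 118766 * q ^ 3 + 648783 * q ^ 2 + 1592164 * q + 1481760) • (w ^ 3) := by
  refine smul_right_injective A (show 4 * (q + 3) * (q + 2) * (q + 1) ^ 2 * (2 * q + 3) * (3 * q
      + 4) ^ 2 ≠ 0 by positivity) ?_
  dsimp only
  linear_combination (norm := algebra)
    (1050 * q ^ 6 + 10325 * q ^ 5 + 40775 * q ^ 4 + 83125 * q ^ 3 + 92575 * q ^ 2 + 53550 * q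
      + 12600) • ((x * w) * h.rel_yz)
    + (-85050 * q ^ 6 - 992880 * q ^ 5 - 4621470 * q ^ 4 - 10987480 * q ^ 3 - 14128240 * q ^ 2
      - 9354240 * q - 2499840) • (w * h.rel_xyw hq)
    + (-126 * q ^ 6 - 1218 * q ^ 5 - 4718 * q ^ 4 - 9422 * q ^ 3 - 10276 * q ^ 2 - 5824 * q
      - 1344) • (w * h.rel_yyw hq)
    + (-188160 * q ^ 7 - 4828860 * q ^ 6 - 44889830 * q ^ 5 - 211848870 * q ^ 4
      - 562920090 * q ^ 3 - 850584690 * q ^ 2 - 680153820 * q - 222878880) • (w * h.rel_xxxx hq)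
    + (75600 * q ^ 6 + 743400 * q ^ 5 + 2935800 * q ^ 4 + 5985000 * q ^ 3 + 6665400 * q ^ 2
      + 3855600 * q + 907200) • (y * h.rel_yww hq)
    + (94080 * q ^ 7 + 1458450 * q ^ 6 + 9530185 * q ^ 5 + 33580715 * q ^ 4 + 68352795 * q ^ 3
      + 80155775 * q ^ 2 + 50159340 * q + 12941460) • (x * h.rel_yww hq)
    + (682080 * q ^ 7 + 10421790 * q ^ 6 + 71308215 * q ^ 5 + 279534145 * q ^ 4
      + 664737995 * q ^ 3 + 940669685 * q ^ 2 + 723619410 * q + 231711480) • (x * h.rel_xxxw hq)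
    + (94080 * q ^ 7 + 1430100 * q ^ 6 + 9109030 * q ^ 5 + 31279220 * q ^ 4 + 62227340 * q ^ 3
      + 71588860 * q ^ 2 + 44103150 * q + 11235420) • (h.rel_xxzw hq)

theorem Relations.rel_zzz (h : Relations q x y z w) (hq : 0 < q) :
    (8505000 : ℚ) • (z ^ 3) =
      (-592704 * q ^ 6 - 13332816 * q ^ 5 - 122895354 * q ^ 4 - 599133697 * q ^ 3
        - 1641491847 * q ^ 2 - 2412262412 * q - 1493614080) • (w ^ 3) := by
  refine smul_right_injective A (show 8 * (q + 3) * (q + 1) * (2 * q + 3) ^ 2 ≠ 0 by positivity) ?_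
  dsimp only
  linear_combination (norm := algebra)
    (50400 * q ^ 4 + 352800 * q ^ 3 + 869400 * q ^ 2 + 907200 * q + 340200) • ((y * w) * h.rel_yz)
    + (-8505000 * q ^ 3 - 46777500 * q ^ 2 - 76545000 * q - 38272500) • ((y * w) * h.rel_xxy)
    + (7902720 * q ^ 5 + 51219840 * q ^ 4 + 91751520 * q ^ 3 - 15780240 * q ^ 2 - 163326240 * q
      - 99111600) • ((x * w) * h.rel_xxy)
    + (15456 * q ^ 5 + 9714432 * q ^ 4 + 77086296 * q ^ 3 + 218653848 * q ^ 2 + 259200648 * q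
      + 107934120) • (w * h.rel_xyw hq)
    + (5103000 * q ^ 3 + 28066500 * q ^ 2 + 45927000 * q + 22963500) • (z * h.rel_xyw hq)
    + (4725 * q ^ 2 + 18900 * q + 14175) • ((x ^ 2) * h.rel_yyw hq)
    + (-23625 * q ^ 4 - 184345 * q ^ 3 - 510685 * q ^ 2 - 591255 * q - 241290) • (w * h.rel_yyw hq)
    + (-10080 * q ^ 3 - 55440 * q ^ 2 - 90720 * q - 45360) • (z * h.rel_yyw hq)
    + (12644352 * q ^ 6 + 217893984 * q ^ 5 + 1265863902 * q ^ 4 + 3288037521 * q ^ 3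
      + 3874097886 * q ^ 2 + 1596787605 * q - 31345650) • (w * h.rel_xxxx hq)
    + (47840625 * q ^ 2 + 191362500 * q + 143521875) • (z * h.rel_xxxx hq)
    + (31610880 * q ^ 6 + 201801600 * q ^ 5 + 231484020 * q ^ 4 - 788083260 * q ^ 3
      - 1769569215 * q ^ 2 - 458422650 * q + 443228625) • (x * h.rel_xxxw hq)
    + (-6322176 * q ^ 6 - 58326912 * q ^ 5 - 201590046 * q ^ 4 - 309961323 * q ^ 3
      - 173031453 * q ^ 2 + 30053835 * q + 42709275) • (h.rel_xxzw hq)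
    + (9483264 * q ^ 8 + 127370880 * q ^ 7 + 197407854 * q ^ 6 - 4150071261 * q ^ 5
      - 27420027915 * q ^ 4 - 76011988143 * q ^ 3 - 109216264563 * q ^ 2 - 79606513476 * q
      - 23211800640) • (h.rel_zww hq)
    + (-32400 * q ^ 5 - 307920 * q ^ 4 - 1126740 * q ^ 3 - 1982520 * q ^ 2 - 1678860 * q
      - 547560) • (h.rel_zzw hq)

theorem Relations.rel_xwww (h : Relations q x y z w) (hq : 0 < q) :
    x * w ^ 3 =
      0 := by
  refine smul_right_injective A (show 4 * (2 * q + 7) * (2 * q + 1) ≠ 0 by positivity) ?_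
  dsimp only
  linear_combination (norm := algebra)
    (-7 : ℚ) • (w * h.rel_xxxw hq) + (5 : ℚ) • (x * h.rel_xxww hq)

theorem Relations.rel_ywww (h : Relations q x y z w) (hq : 0 < q) :
    y * w ^ 3 =
      0 := by
  refine smul_right_injective A (show 15 * (3 * q + 4) ≠ 0 by positivity) ?_
  dsimp only
  linear_combination (norm := algebra)
    w * h.rel_yww hq + (15 : ℚ) • (x * h.rel_zww hq)
    + (26 * q ^ 2 + 139 * q + 168) • (h.rel_xwww hq)

theorem Relations.rel_wwww (h : Relations q x y z w) (hq : 0 < q) :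
    w ^ 4 =
      0 := by
  refine smul_right_injective A (show (q + 4) * q ≠ 0 by positivity) ?_
  dsimp only
  linear_combination (norm := algebra)
    (-1 : ℚ) • (w * h.rel_xxww hq) + (7 : ℚ) • (x * h.rel_xwww hq)

/-- The span of those elements of a basis of the weight-`n` part of the quotient which lie in the
ideal generated by `x ^ 2`, `z` and `w`. -/
def idealPart (x y z w : A) : ℕ → Submodule ℚ A
  | 2 => Submodule.span ℚ {x ^ 2, z, w}
  | 3 => Submodule.span ℚ {x ^ 3, y * w, x * w, x * z}
  | 4 => Submodule.span ℚ {x ^ 2 * w, w ^ 2, x ^ 2 * z, z * w, z ^ 2}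
  | 5 => Submodule.span ℚ {x * w ^ 2, x * z * w}
  | 6 => Submodule.span ℚ {w ^ 3}
  | _ => ⊥

theorem mem_of_smul_eq {S : Submodule ℚ A} {c : ℚ} (hc : c ≠ 0) {m v : A}
    (h : c • m = v) (hv : v ∈ S) : m ∈ S :=
  (S.smul_mem_iff hc).1 (h ▸ hv)

theorem mul_mem_of_mem_span {s : Set A} {S : Submodule ℚ A} {t m : A}
    (hs : ∀ b ∈ s, t * b ∈ S) (hm : m ∈ Submodule.span ℚ s) : t * m ∈ S :=
  (Submodule.span_le (p := S.comap (LinearMap.mulLeft ℚ t))).2 hs hm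

namespace Relations

theorem yz_mem (h : Relations q x y z w) :
    y * z ∈ idealPart x y z w 3 := by
  refine mem_of_smul_eq (by positivity) (h.rel_yz) ?_
  apply_rules [Submodule.add_mem, Submodule.smul_mem]
  all_goals exact Submodule.subset_span (by simp)

theorem xxy_mem (h : Relations q x y z w) :
    x ^ 2 * y ∈ idealPart x y z w 3 := by
  refine mem_of_smul_eq (by positivity) (h.rel_xxy) ?_
  apply_rules [Submodule.add_mem, Submodule.smul_mem]
  all_goals exact Submodule.subset_span (by simp)

theorem xyw_mem (h : Relations q x y z w) (hq : 0 < q) :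
    x * y * w ∈ idealPart x y z w 4 := by
  refine mem_of_smul_eq (by positivity) (h.rel_xyw hq) ?_
  apply_rules [Submodule.add_mem, Submodule.smul_mem]
  all_goals exact Submodule.subset_span (by simp)

theorem yyw_mem (h : Relations q x y z w) (hq : 0 < q) :
    y ^ 2 * w ∈ idealPart x y z w 4 := by
  refine mem_of_smul_eq (by positivity) (h.rel_yyw hq) ?_
  apply_rules [Submodule.add_mem, Submodule.smul_mem]
  all_goals exact Submodule.subset_span (by simp)

theorem xxxx_mem (h : Relations q x y z w) (hq : 0 < q) :
    x ^ 4 ∈ idealPart x y z w 4 := by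
  refine mem_of_smul_eq (by positivity) (h.rel_xxxx hq) ?_
  apply_rules [Submodule.add_mem, Submodule.smul_mem]
  all_goals exact Submodule.subset_span (by simp)

theorem yww_mem (h : Relations q x y z w) (hq : 0 < q) :
    y * w ^ 2 ∈ idealPart x y z w 5 := by
  refine mem_of_smul_eq (by positivity) (h.rel_yww hq) ?_
  apply_rules [Submodule.add_mem, Submodule.smul_mem]
  all_goals exact Submodule.subset_span (by simp)

theorem xzz_mem (h : Relations q x y z w) (hq : 0 < q) :
    x * z ^ 2 ∈ idealPart x y z w 5 := by
  refine mem_of_smul_eq (by positivity) (h.rel_xzz hq) ?_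
  apply_rules [Submodule.add_mem, Submodule.smul_mem]
  all_goals exact Submodule.subset_span (by simp)

theorem xxxz_mem (h : Relations q x y z w) (hq : 0 < q) :
    x ^ 3 * z ∈ idealPart x y z w 5 := by
  refine mem_of_smul_eq (by positivity) (h.rel_xxxz hq) ?_
  apply_rules [Submodule.add_mem, Submodule.smul_mem]
  all_goals exact Submodule.subset_span (by simp)

theorem xxxw_mem (h : Relations q x y z w) (hq : 0 < q) :
    x ^ 3 * w ∈ idealPart x y z w 5 := by
  refine mem_of_smul_eq (by positivity) (h.rel_xxxw hq) ?_
  apply_rules [Submodule.add_mem, Submodule.smul_mem]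
  all_goals exact Submodule.subset_span (by simp)

theorem xxww_mem (h : Relations q x y z w) (hq : 0 < q) :
    x ^ 2 * w ^ 2 ∈ idealPart x y z w 6 := by
  refine mem_of_smul_eq (by positivity) (h.rel_xxww hq) ?_
  apply_rules [Submodule.add_mem, Submodule.smul_mem]
  all_goals exact Submodule.subset_span (by simp)

theorem xxzw_mem (h : Relations q x y z w) (hq : 0 < q) :
    x ^ 2 * z * w ∈ idealPart x y z w 6 := by
  refine mem_of_smul_eq (by positivity) (h.rel_xxzw hq) ?_
  apply_rules [Submodule.add_mem, Submodule.smul_mem]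
  all_goals exact Submodule.subset_span (by simp)

theorem zww_mem (h : Relations q x y z w) (hq : 0 < q) :
    z * w ^ 2 ∈ idealPart x y z w 6 := by
  refine mem_of_smul_eq (by positivity) (h.rel_zww hq) ?_
  apply_rules [Submodule.add_mem, Submodule.smul_mem]
  all_goals exact Submodule.subset_span (by simp)

theorem zzw_mem (h : Relations q x y z w) (hq : 0 < q) :
    z ^ 2 * w ∈ idealPart x y z w 6 := by
  refine mem_of_smul_eq (by positivity) (h.rel_zzw hq) ?_
  apply_rules [Submodule.add_mem, Submodule.smul_mem]
  all_goals exact Submodule.subset_span (by simp)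

theorem zzz_mem (h : Relations q x y z w) (hq : 0 < q) :
    z ^ 3 ∈ idealPart x y z w 6 := by
  refine mem_of_smul_eq (by positivity) (h.rel_zzz hq) ?_
  apply_rules [Submodule.add_mem, Submodule.smul_mem]
  all_goals exact Submodule.subset_span (by simp)

theorem x_mul_mem (h : Relations q x y z w) (hq : 0 < q) {n : ℕ} {m : A}
    (hm : m ∈ idealPart x y z w n) : x * m ∈ idealPart x y z w (n + 1) := by
  match n with
  | 0 | 1 | n + 7 =>
    have h0 : m = 0 := by simpa [idealPart] using hm
    rw [h0, mul_zero]
    exact zero_mem _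
  | 2 =>
    refine mul_mem_of_mem_span ?_ hm
    simp only [Set.mem_insert_iff, Set.mem_singleton_iff, forall_eq_or_imp, forall_eq]
    refine ⟨?_, ?_, ?_⟩
    · rw [show x * x ^ 2 = x ^ 3 by ring]
      exact Submodule.subset_span (by simp)
    · exact Submodule.subset_span (by simp)
    · exact Submodule.subset_span (by simp)
  | 3 =>
    refine mul_mem_of_mem_span ?_ hm
    simp only [Set.mem_insert_iff, Set.mem_singleton_iff, forall_eq_or_imp, forall_eq]
    refine ⟨?_, ?_, ?_, ?_⟩
    · rw [show x * x ^ 3 = x ^ 4 by ring]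
      exact h.xxxx_mem hq
    · rw [show x * (y * w) = x * y * w by ring]
      exact h.xyw_mem hq
    · rw [show x * (x * w) = x ^ 2 * w by ring]
      exact Submodule.subset_span (by simp)
    · rw [show x * (x * z) = x ^ 2 * z by ring]
      exact Submodule.subset_span (by simp)
  | 4 =>
    refine mul_mem_of_mem_span ?_ hm
    simp only [Set.mem_insert_iff, Set.mem_singleton_iff, forall_eq_or_imp, forall_eq]
    refine ⟨?_, ?_, ?_, ?_, ?_⟩
    · rw [show x * (x ^ 2 * w) = x ^ 3 * w by ring]
      exact h.xxxw_mem hq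
    · exact Submodule.subset_span (by simp)
    · rw [show x * (x ^ 2 * z) = x ^ 3 * z by ring]
      exact h.xxxz_mem hq
    · rw [show x * (z * w) = x * z * w by ring]
      exact Submodule.subset_span (by simp)
    · exact h.xzz_mem hq
  | 5 =>
    refine mul_mem_of_mem_span ?_ hm
    simp only [Set.mem_insert_iff, Set.mem_singleton_iff, forall_eq_or_imp, forall_eq]
    refine ⟨?_, ?_⟩
    · rw [show x * (x * w ^ 2) = x ^ 2 * w ^ 2 by ring]
      exact h.xxww_mem hq
    · rw [show x * (x * z * w) = x ^ 2 * z * w by ring]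
      exact h.xxzw_mem hq
  | 6 =>
    refine mul_mem_of_mem_span ?_ hm
    simp only [Set.mem_singleton_iff, forall_eq]
    · rw [show x * w ^ 3 = x * w ^ 3 by ring, h.rel_xwww hq]
      exact zero_mem _

theorem w_mul_mem (h : Relations q x y z w) (hq : 0 < q) {n : ℕ} {m : A}
    (hm : m ∈ idealPart x y z w n) : w * m ∈ idealPart x y z w (n + 2) := by
  match n with
  | 0 | 1 | n + 7 =>
    have h0 : m = 0 := by simpa [idealPart] using hm
    rw [h0, mul_zero]
    exact zero_mem _
  | 2 =>
    refine mul_mem_of_mem_span ?_ hm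
    simp only [Set.mem_insert_iff, Set.mem_singleton_iff, forall_eq_or_imp, forall_eq]
    refine ⟨?_, ?_, ?_⟩
    · rw [show w * x ^ 2 = x ^ 2 * w by ring]
      exact Submodule.subset_span (by simp)
    · rw [show w * z = z * w by ring]
      exact Submodule.subset_span (by simp)
    · rw [show w * w = w ^ 2 by ring]
      exact Submodule.subset_span (by simp)
  | 3 =>
    refine mul_mem_of_mem_span ?_ hm
    simp only [Set.mem_insert_iff, Set.mem_singleton_iff, forall_eq_or_imp, forall_eq]
    refine ⟨?_, ?_, ?_, ?_⟩
    · rw [show w * x ^ 3 = x ^ 3 * w by ring]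
      exact h.xxxw_mem hq
    · rw [show w * (y * w) = y * w ^ 2 by ring]
      exact h.yww_mem hq
    · rw [show w * (x * w) = x * w ^ 2 by ring]
      exact Submodule.subset_span (by simp)
    · rw [show w * (x * z) = x * z * w by ring]
      exact Submodule.subset_span (by simp)
  | 4 =>
    refine mul_mem_of_mem_span ?_ hm
    simp only [Set.mem_insert_iff, Set.mem_singleton_iff, forall_eq_or_imp, forall_eq]
    refine ⟨?_, ?_, ?_, ?_, ?_⟩
    · rw [show w * (x ^ 2 * w) = x ^ 2 * w ^ 2 by ring]
      exact h.xxww_mem hq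
    · rw [show w * w ^ 2 = w ^ 3 by ring]
      exact Submodule.subset_span (by simp)
    · rw [show w * (x ^ 2 * z) = x ^ 2 * z * w by ring]
      exact h.xxzw_mem hq
    · rw [show w * (z * w) = z * w ^ 2 by ring]
      exact h.zww_mem hq
    · rw [show w * z ^ 2 = z ^ 2 * w by ring]
      exact h.zzw_mem hq
  | 5 =>
    refine mul_mem_of_mem_span ?_ hm
    simp only [Set.mem_insert_iff, Set.mem_singleton_iff, forall_eq_or_imp, forall_eq]
    refine ⟨?_, ?_⟩
    · rw [show w * (x * w ^ 2) = x * w ^ 3 by ring, h.rel_xwww hq]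
      exact zero_mem _
    · rw [show w * (x * z * w) = x * (z * w ^ 2) by ring]
      exact h.x_mul_mem hq (h.zww_mem hq)
  | 6 =>
    refine mul_mem_of_mem_span ?_ hm
    simp only [Set.mem_singleton_iff, forall_eq]
    · rw [show w * w ^ 3 = w ^ 4 by ring, h.rel_wwww hq]
      exact zero_mem _

theorem z_mul_mem (h : Relations q x y z w) (hq : 0 < q) {n : ℕ} {m : A}
    (hm : m ∈ idealPart x y z w n) : z * m ∈ idealPart x y z w (n + 2) := by
  match n with
  | 0 | 1 | n + 7 =>
    have h0 : m = 0 := by simpa [idealPart] using hm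
    rw [h0, mul_zero]
    exact zero_mem _
  | 2 =>
    refine mul_mem_of_mem_span ?_ hm
    simp only [Set.mem_insert_iff, Set.mem_singleton_iff, forall_eq_or_imp, forall_eq]
    refine ⟨?_, ?_, ?_⟩
    · rw [show z * x ^ 2 = x ^ 2 * z by ring]
      exact Submodule.subset_span (by simp)
    · rw [show z * z = z ^ 2 by ring]
      exact Submodule.subset_span (by simp)
    · exact Submodule.subset_span (by simp)
  | 3 =>
    refine mul_mem_of_mem_span ?_ hm
    simp only [Set.mem_insert_iff, Set.mem_singleton_iff, forall_eq_or_imp, forall_eq]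
    refine ⟨?_, ?_, ?_, ?_⟩
    · rw [show z * x ^ 3 = x ^ 3 * z by ring]
      exact h.xxxz_mem hq
    · rw [show z * (y * w) = w * (y * z) by ring]
      exact h.w_mul_mem hq h.yz_mem
    · rw [show z * (x * w) = x * z * w by ring]
      exact Submodule.subset_span (by simp)
    · rw [show z * (x * z) = x * z ^ 2 by ring]
      exact h.xzz_mem hq
  | 4 =>
    refine mul_mem_of_mem_span ?_ hm
    simp only [Set.mem_insert_iff, Set.mem_singleton_iff, forall_eq_or_imp, forall_eq]
    refine ⟨?_, ?_, ?_, ?_, ?_⟩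
    · rw [show z * (x ^ 2 * w) = x ^ 2 * z * w by ring]
      exact h.xxzw_mem hq
    · exact h.zww_mem hq
    · rw [show z * (x ^ 2 * z) = x * (x * z ^ 2) by ring]
      exact h.x_mul_mem hq (h.xzz_mem hq)
    · rw [show z * (z * w) = z ^ 2 * w by ring]
      exact h.zzw_mem hq
    · rw [show z * z ^ 2 = z ^ 3 by ring]
      exact h.zzz_mem hq
  | 5 =>
    refine mul_mem_of_mem_span ?_ hm
    simp only [Set.mem_insert_iff, Set.mem_singleton_iff, forall_eq_or_imp, forall_eq]
    refine ⟨?_, ?_⟩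
    · rw [show z * (x * w ^ 2) = x * (z * w ^ 2) by ring]
      exact h.x_mul_mem hq (h.zww_mem hq)
    · rw [show z * (x * z * w) = x * (z ^ 2 * w) by ring]
      exact h.x_mul_mem hq (h.zzw_mem hq)
  | 6 =>
    refine mul_mem_of_mem_span ?_ hm
    simp only [Set.mem_singleton_iff, forall_eq]
    · rw [show z * w ^ 3 = w * (z * w ^ 2) by ring]
      exact h.w_mul_mem hq (h.zww_mem hq)

theorem y_mul_mem (h : Relations q x y z w) (hq : 0 < q) {n : ℕ} {m : A}
    (hm : m ∈ idealPart x y z w n) : y * m ∈ idealPart x y z w (n + 1) := by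
  match n with
  | 0 | 1 | n + 7 =>
    have h0 : m = 0 := by simpa [idealPart] using hm
    rw [h0, mul_zero]
    exact zero_mem _
  | 2 =>
    refine mul_mem_of_mem_span ?_ hm
    simp only [Set.mem_insert_iff, Set.mem_singleton_iff, forall_eq_or_imp, forall_eq]
    refine ⟨?_, ?_, ?_⟩
    · rw [show y * x ^ 2 = x ^ 2 * y by ring]
      exact h.xxy_mem
    · exact h.yz_mem
    · exact Submodule.subset_span (by simp)
  | 3 =>
    refine mul_mem_of_mem_span ?_ hm
    simp only [Set.mem_insert_iff, Set.mem_singleton_iff, forall_eq_or_imp, forall_eq]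
    refine ⟨?_, ?_, ?_, ?_⟩
    · rw [show y * x ^ 3 = x * (x ^ 2 * y) by ring]
      exact h.x_mul_mem hq h.xxy_mem
    · rw [show y * (y * w) = y ^ 2 * w by ring]
      exact h.yyw_mem hq
    · rw [show y * (x * w) = x * y * w by ring]
      exact h.xyw_mem hq
    · rw [show y * (x * z) = x * (y * z) by ring]
      exact h.x_mul_mem hq h.yz_mem
  | 4 =>
    refine mul_mem_of_mem_span ?_ hm
    simp only [Set.mem_insert_iff, Set.mem_singleton_iff, forall_eq_or_imp, forall_eq]
    refine ⟨?_, ?_, ?_, ?_, ?_⟩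
    · rw [show y * (x ^ 2 * w) = x * (x * y * w) by ring]
      exact h.x_mul_mem hq (h.xyw_mem hq)
    · exact h.yww_mem hq
    · rw [show y * (x ^ 2 * z) = x * (x * (y * z)) by ring]
      exact h.x_mul_mem hq (h.x_mul_mem hq h.yz_mem)
    · rw [show y * (z * w) = w * (y * z) by ring]
      exact h.w_mul_mem hq h.yz_mem
    · rw [show y * z ^ 2 = z * (y * z) by ring]
      exact h.z_mul_mem hq h.yz_mem
  | 5 =>
    refine mul_mem_of_mem_span ?_ hm
    simp only [Set.mem_insert_iff, Set.mem_singleton_iff, forall_eq_or_imp, forall_eq]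
    refine ⟨?_, ?_⟩
    · rw [show y * (x * w ^ 2) = x * (y * w ^ 2) by ring]
      exact h.x_mul_mem hq (h.yww_mem hq)
    · rw [show y * (x * z * w) = x * (w * (y * z)) by ring]
      exact h.x_mul_mem hq (h.w_mul_mem hq h.yz_mem)
  | 6 =>
    refine mul_mem_of_mem_span ?_ hm
    simp only [Set.mem_singleton_iff, forall_eq]
    · rw [show y * w ^ 3 = y * w ^ 3 by ring, h.rel_ywww hq]
      exact zero_mem _

theorem pow_mul_mem {t : A} {k : ℕ}
    (ht : ∀ {n : ℕ} {m : A}, m ∈ idealPart x y z w n → t * m ∈ idealPart x y z w (n + k))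
    (e : ℕ) {n : ℕ} {m : A} (hm : m ∈ idealPart x y z w n) :
    t ^ e * m ∈ idealPart x y z w (n + e * k) := by
  induction e with
  | zero => simpa using hm
  | succ e ih =>
    rw [pow_succ', mul_assoc, add_mul, one_mul, ← add_assoc]
    exact ht ih

theorem monomial_mul_mem (h : Relations q x y z w) (hq : 0 < q) {k n : ℕ} {m : A}
    (hm : m ∈ idealPart x y z w k) (a b c d : ℕ) (hn : k + a + b + 2 * c + 2 * d = n) :
    x ^ a * (y ^ b * (z ^ c * (w ^ d * m))) ∈ idealPart x y z w n := by
  have := pow_mul_mem (h.x_mul_mem hq) a <| pow_mul_mem (h.y_mul_mem hq) b <|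
    pow_mul_mem (h.z_mul_mem hq) c <| pow_mul_mem (h.w_mul_mem hq) d hm
  convert this using 1
  subst hn
  ring_nf

theorem monomial_mem (h : Relations q x y z w) (hq : 0 < q) {n : ℕ} (a b c d : ℕ)
    (hn : a + b + 2 * c + 2 * d = n + 1) :
    x ^ a * y ^ b * z ^ c * w ^ d ∈
      Submodule.span ℚ {y ^ (n + 1), x * y ^ n} ⊔ idealPart x y z w (n + 1) := by
  have hbasis (m : A) (hm : m ∈ ({x ^ 2, z, w} : Set A)) : m ∈ idealPart x y z w 2 :=
    Submodule.subset_span hm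
  match a, c, d with
  | 0, 0, 0 =>
    obtain rfl : b = n + 1 := by lia
    exact Submodule.mem_sup_left (Submodule.subset_span (by simp))
  | 1, 0, 0 =>
    obtain rfl : b = n := by lia
    exact Submodule.mem_sup_left (Submodule.subset_span (by simp))
  | a + 2, c, d =>
    refine Submodule.mem_sup_right ?_
    convert h.monomial_mul_mem hq (hbasis (x ^ 2) (by simp)) a b c d (n := n + 1) (by lia) using 1
    ring
  | a, c + 1, d =>
    refine Submodule.mem_sup_right ?_
    convert h.monomial_mul_mem hq (hbasis z (by simp)) a b c d (n := n + 1) (by lia) using 1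
    ring
  | a, c, d + 1 =>
    refine Submodule.mem_sup_right ?_
    convert h.monomial_mul_mem hq (hbasis w (by simp)) a b c d (n := n + 1) (by lia) using 1
    ring

end Relations

end
/-- The monomial `a₁ ^ a * a₂′ ^ b * a₂ ^ c * c₂ ^ d`. -/
def mon (a b c d : ℕ) : P4 := a1 ^ a * a2' ^ b * a2 ^ c * c2 ^ d

theorem mon_mul_mon (a b c d a' b' c' d' : ℕ) :
    mon a b c d * mon a' b' c' d' = mon (a + a') (b + b') (c + c') (d + d') := by
  simp only [mon]
  ring

theorem monomial_eq_mon (s : Fin 4 →₀ ℕ) : monomial s (1 : ℚ) = mon (s 0) (s 1) (s 2) (s 3) := by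
  rw [monomial_eq, Finsupp.prod_fintype _ _ (by simp), Fin.prod_univ_four]
  simp [mon, a1, a2', a2, c2]

theorem mon_eq_monomial (a b c d : ℕ) :
    mon a b c d = monomial (Finsupp.equivFunOnFinite.symm ![a, b, c, d]) 1 := by
  simp [monomial_eq_mon]

theorem weight_eq (s : Fin 4 →₀ ℕ) :
    Finsupp.weight wt s = s 0 + s 1 + 2 * s 2 + 2 * s 3 := by
  simp [Finsupp.weight_apply, Finsupp.sum_fintype, Fin.sum_univ_four, wt, mul_comm]

theorem isWeightedHomogeneous_mon {a b c d n : ℕ} (hn : a + b + 2 * c + 2 * d = n) :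
    IsWeightedHomogeneous wt (mon a b c d) n := by
  rw [mon_eq_monomial]
  exact isWeightedHomogeneous_monomial _ _ _ (by simp [weight_eq, hn])

theorem relations_mk (g : ℤ) :
    Relations (g : ℚ) (Smk g a1) (Smk g a2') (Smk g a2) (Smk g c2) := by
  have hmk (r : P4) (hr : r ∈ ({r1 g, r2 g, r3 g, r4 g, r5 g} : Set P4)) :
      Ideal.Quotient.mkₐ ℚ (Jg g) r = 0 :=
    Ideal.Quotient.eq_zero_iff_mem.2 (Ideal.subset_span hr)
  have hC (c : ℚ) : Ideal.Quotient.mkₐ ℚ (Jg g) (C c) = algebraMap ℚ _ c :=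
    (Ideal.Quotient.mkₐ ℚ (Jg g)).commutes c
  constructor
  · rw [← hmk (r1 g) (by simp)]
    simp only [Smk, AlgHom.toLinearMap_apply, Algebra.smul_def, r1, map_add, map_sub, map_neg,
      map_mul, map_pow, hC]
    ring
  · rw [← hmk (r2 g) (by simp)]
    simp only [Smk, AlgHom.toLinearMap_apply, Algebra.smul_def, r2, map_add, map_sub, map_neg,
      map_mul, map_pow, hC]
    ring
  · rw [← hmk (r3 g) (by simp)]
    simp only [Smk, AlgHom.toLinearMap_apply, Algebra.smul_def, r3, map_add, map_sub, map_neg,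
      map_mul, map_pow, hC]
    ring
  · rw [← hmk (r4 g) (by simp)]
    simp only [Smk, AlgHom.toLinearMap_apply, Algebra.smul_def, r4, map_add, map_sub, map_neg,
      map_mul, map_pow, hC]
    ring
  · rw [← hmk (r5 g) (by simp)]
    simp only [Smk, AlgHom.toLinearMap_apply, Algebra.smul_def, r5, map_add, map_sub, map_neg,
      map_mul, map_pow, hC]
    ring

/-- The augmentation of `P4` which sends `a₁` to `ε`, `a₂′` to `1` and `a₂`, `c₂` to `0`. -/
def dualEval : P4 →ₐ[ℚ] DualNumber ℚ := aeval ![DualNumber.eps, 1, 0, 0]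

theorem dualEval_mon (a b c d : ℕ) :
    dualEval (mon a b c d) = DualNumber.eps ^ a * 0 ^ c * 0 ^ d := by
  simp [dualEval, mon, a1, a2', a2, c2]

theorem dualEval_eq_zero {g : ℤ} {p : P4} (hp : p ∈ Jg g) : dualEval p = 0 := by
  suffices Jg g ≤ RingHom.ker dualEval from this hp
  refine Ideal.span_le.2 ?_
  have h2 : (DualNumber.eps : DualNumber ℚ) ^ 2 = 0 := by rw [pow_two, DualNumber.eps_mul_eps]
  have h3 : (DualNumber.eps : DualNumber ℚ) ^ 3 = 0 := by rw [pow_succ, h2, zero_mul]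
  have h4 : (DualNumber.eps : DualNumber ℚ) ^ 4 = 0 := by rw [pow_succ, h3, zero_mul]
  rintro _ (rfl | rfl | rfl | rfl | rfl)
  all_goals
    simp [r1, r2, r3, r4, r5, dualEval, a1, a2', a2, c2, h2, h3, h4]

/-- The coefficient of `c₂ ^ 3` in the normal form of the monomial with exponents `a, b, c, d` of
weight `6`, in the basis `a₂′ ^ 6, a₁ * a₂′ ^ 5, c₂ ^ 3`. -/
def socleTable (q : ℚ) : ℕ → ℕ → ℕ → ℕ → ℚ
  | 0, 0, 0, 3 => 1
  | 0, 0, 1, 2 => (-2 * q ^ 2 - 15 * q - 28) / 5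
  | 0, 0, 2, 1 => (8232 * q ^ 4 + 118766 * q ^ 3 + 648783 * q ^ 2 + 1592164 * q + 1481760) / 47250
  | 0, 0, 3, 0 => (-592704 * q ^ 6 - 13332816 * q ^ 5 - 122895354 * q ^ 4 - 599133697 * q ^ 3
      - 1641491847 * q ^ 2 - 2412262412 * q - 1493614080) / 8505000
  | 0, 2, 0, 2 => (1176 * q ^ 4 + 12938 * q ^ 3 + 47349 * q ^ 2 + 57652 * q) / 9450
  | 0, 2, 1, 1 => (-197568 * q ^ 6 - 4444272 * q ^ 5 - 38465286 * q ^ 4 - 161941583 * q ^ 3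
      - 333947241 * q ^ 2 - 271077940 * q) / 8505000
  | 0, 2, 2, 0 => (66382848 * q ^ 8 + 1460196864 * q ^ 7 + 14300875392 * q ^ 6
      + 81777859776 * q ^ 5 + 296399240130 * q ^ 4 + 678384367205 * q ^ 3 + 898127188305 * q ^ 2
      + 523524771700 * q) / 3061800000
  | 0, 4, 0, 1 => (199148544 * q ^ 8 + 4380590592 * q ^ 7 + 40382795520 * q ^ 6
      + 200567968704 * q ^ 5 + 571447568478 * q ^ 4 + 908669237179 * q ^ 3
      + 699671317743 * q ^ 2 + 159155163020 * q) / 3061800000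
  | 0, 4, 1, 0 => (22304636928 * q ^ 10 + 479473827840 * q ^ 9 + 4025077926912 * q ^ 8
      + 14647951984896 * q ^ 7 + 1588676519328 * q ^ 6 - 184131082609632 * q ^ 5
      - 694044842412138 * q ^ 4 - 1162315690192909 * q ^ 3 - 875655446242665 * q ^ 2
      - 186983366479700 * q) / 1102248000000
  | 0, 6, 0, 0 => 0
  | 1, 1, 0, 2 => (2 * q ^ 3 + 15 * q ^ 2 + 28 * q) / 15
  | 1, 1, 1, 1 => (-1176 * q ^ 5 - 22338 * q ^ 4 - 150769 * q ^ 3 - 436152 * q ^ 2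
      - 460880 * q) / 47250
  | 1, 1, 2, 0 => (197568 * q ^ 7 + 3654672 * q ^ 6 + 29776314 * q ^ 5 + 139206147 * q ^ 4
      + 395039348 * q ^ 3 + 636540321 * q ^ 2 + 445134340 * q) / 8505000
  | 1, 3, 0, 1 => (592704 * q ^ 7 + 10964016 * q ^ 6 + 81829446 * q ^ 5 + 310635693 * q ^ 4
      + 613889020 * q ^ 3 + 556468671 * q ^ 2 + 135433340 * q) / 8505000
  | 1, 3, 1, 0 => (66382848 * q ^ 9 + 1194891264 * q ^ 8 + 7801343424 * q ^ 7
      + 16319071104 * q ^ 6 - 52294939026 * q ^ 5 - 364884065463 * q ^ 4 - 788795666566 * q ^ 3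
      - 699466436205 * q ^ 2 - 159152590100 * q) / 3061800000
  | 1, 5, 0, 0 => 0
  | 2, 0, 0, 2 => (q ^ 2 + 4 * q) / 7
  | 2, 0, 1, 1 => (-2 * q ^ 4 - 31 * q ^ 3 - 148 * q ^ 2 - 224 * q) / 75
  | 2, 0, 2, 0 => (1176 * q ^ 6 + 17642 * q ^ 5 + 115561 * q ^ 4 + 424598 * q ^ 3
      + 866798 * q ^ 2 + 757400 * q) / 47250
  | 2, 2, 0, 1 => (3528 * q ^ 6 + 52918 * q ^ 5 + 301919 * q ^ 4 + 792562 * q ^ 3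
      + 880738 * q ^ 2 + 230440 * q) / 47250
  | 2, 2, 1, 0 => (197568 * q ^ 8 + 2865072 * q ^ 7 + 13194726 * q ^ 6
      + 2401723 * q ^ 5 - 164067739 * q ^ 4 - 511998275 * q ^ 3 - 556311785 * q ^ 2
      - 135432500 * q) / 8505000
  | 2, 4, 0, 0 => (331914240 * q ^ 10 + 8627738112 * q ^ 9 + 97373809152 * q ^ 8
      + 622782599232 * q ^ 7 + 2468215161762 * q ^ 6 + 6215335249417 * q ^ 5
      + 9777790002605 * q ^ 4 + 9032135437579 * q ^ 3 + 4292006147281 * q ^ 2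
      + 795763862740 * q) / 3061800000
  | 3, 1, 0, 1 => (6 * q ^ 5 + 69 * q ^ 4 + 272 * q ^ 3 + 396 * q ^ 2 + 112 * q) / 75
  | 3, 1, 1, 0 => (1176 * q ^ 7 + 12938 * q ^ 6 + 33249 * q ^ 5 - 102178 * q ^ 4
      - 619460 * q ^ 3 - 880570 * q ^ 2 - 230440 * q) / 47250
  | 3, 3, 0, 0 => (987840 * q ^ 9 + 22223376 * q ^ 8 + 212085210 * q ^ 7 + 1111796455 * q ^ 6
      + 3457435596 * q ^ 5 + 6405406732 * q ^ 4 + 6696691964 * q ^ 3 + 3458614357 * q ^ 2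
      + 677164180 * q) / 8505000
  | 4, 0, 0, 1 => (3 * q ^ 4 + 24 * q ^ 3 + 52 * q ^ 2 + 16 * q) / 35
  | 4, 0, 1, 0 => (2 * q ^ 6 + 15 * q ^ 5 + 4 * q ^ 4 - 188 * q ^ 3 - 396 * q ^ 2 - 112 * q) / 75
  | 4, 2, 0, 0 => (5880 * q ^ 8 + 111714 * q ^ 7 + 871625 * q ^ 6 + 3568688 * q ^ 5
      + 8095464 * q ^ 4 + 9806018 * q ^ 3 + 5555386 * q ^ 2 + 1152200 * q) / 47250
  | 5, 1, 0, 0 => (2 * q ^ 7 + 31 * q ^ 6 + 188 * q ^ 5 + 556 * q ^ 4 + 808 * q ^ 3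
      + 508 * q ^ 2 + 112 * q) / 15
  | 6, 0, 0, 0 => (q ^ 6 + 12 * q ^ 5 + 52 * q ^ 4 + 96 * q ^ 3 + 68 * q ^ 2 + 16 * q) / 7
  | _, _, _, _ => 0

/-- The functional on `P4` vanishing outside weight `6` with values `socleTable` there. -/
def socle (q : ℚ) : P4 →ₗ[ℚ] ℚ :=
  (basisMonomials (Fin 4) ℚ).constr ℚ fun s =>
    if s 0 + s 1 + 2 * s 2 + 2 * s 3 = 6 then socleTable q (s 0) (s 1) (s 2) (s 3) else 0

theorem socle_mon (q : ℚ) (a b c d : ℕ) :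
    socle q (mon a b c d) =
      if a + b + 2 * c + 2 * d = 6 then socleTable q a b c d else 0 := by
  have h := (basisMonomials (Fin 4) ℚ).constr_basis ℚ (fun s =>
    if s 0 + s 1 + 2 * s 2 + 2 * s 3 = 6 then socleTable q (s 0) (s 1) (s 2) (s 3) else 0)
    (Finsupp.equivFunOnFinite.symm ![a, b, c, d])
  rw [coe_basisMonomials] at h
  beta_reduce at h
  rw [← mon_eq_monomial] at h
  simpa [socle] using h

theorem mon_mul_r1 (g : ℤ) (a b c d : ℕ) :
    mon a b c d * r1 g =
      (1064 * (g : ℚ) + 3610) • mon (a + 3) b c d + (-1074 : ℚ) • mon (a + 2) (b + 1) c d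
      + (-2148 * (g : ℚ) - 7272) • mon (a + 1) b (c + 1) d
      + (2160 : ℚ) • mon a (b + 1) (c + 1) d
      + (-1064 * (g : ℚ) ^ 3 - 10830 * (g : ℚ) ^ 2 - 36680 * (g : ℚ) - 41360) • mon (a
        + 1) b c (d + 1)
      + (1074 * (g : ℚ) ^ 2 + 7272 * (g : ℚ) + 12288) • mon a (b + 1) c (d + 1) := by
  simp only [r1, mon, smul_eq_C_mul, map_add, map_sub, map_neg, map_mul, map_pow, map_ofNat]
  ring

theorem mon_mul_r2 (g : ℤ) (a b c d : ℕ) :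
    mon a b c d * r2 g =
      (-6412 * (g : ℚ) - 21255) • mon (a + 3) b c d + (6207 : ℚ) • mon (a + 2) (b + 1) c d
      + (12414 * (g : ℚ) + 40896) • mon (a + 1) b (c + 1) d
      + (-11880 : ℚ) • mon a (b + 1) (c + 1) d
      + (6412 * (g : ℚ) ^ 3 + 63765 * (g : ℚ) ^ 2 + 211540 * (g : ℚ) + 234480) • mon (a
        + 1) b c (d + 1)
      + (-6207 * (g : ℚ) ^ 2 - 40896 * (g : ℚ) - 68184) • mon a (b + 1) c (d + 1) := by
  simp only [r2, mon, smul_eq_C_mul, map_add, map_sub, map_neg, map_mul, map_pow, map_ofNat]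
  ring

theorem mon_mul_r3 (g : ℤ) (a b c d : ℕ) :
    mon a b c d * r3 g =
      (-22845 * (g : ℚ) - 67763) • mon (a + 4) b c d + (18141 : ℚ) • mon (a + 3) (b + 1) c d
      + (54423 * (g : ℚ) + 146550) • mon (a + 2) b (c + 1) d
      + (-35640 : ℚ) • mon (a + 1) (b + 1) (c + 1) d
      + (45690 * (g : ℚ) ^ 3 + 406578 * (g : ℚ) ^ 2 + 1184220 * (g : ℚ) + 1123060) • mon (a
        + 2) b c (d + 1)
      + (-54423 * (g : ℚ) ^ 2 - 293100 * (g : ℚ) - 372648) • mon (a + 1) (b + 1) c (d + 1)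
      + (17820 * (g : ℚ) + 24840) • mon a (b + 2) c (d + 1)
      + (-17820 * (g : ℚ) - 24840) • mon a b (c + 2) d
      + (-18141 * (g : ℚ) ^ 3 - 146550 * (g : ℚ) ^ 2 - 372648 * (g : ℚ) - 283824) • mon a b (c
        + 1) (d + 1)
      + (-4569 * (g : ℚ) ^ 5 - 67763 * (g : ℚ) ^ 4 - 394740 * (g : ℚ) ^ 3
        - 1123060 * (g : ℚ) ^ 2 - 1546176 * (g : ℚ) - 810432) • mon a b c (d + 2) := by
  simp only [r3, mon, smul_eq_C_mul, map_add, map_sub, map_neg, map_mul, map_pow, map_ofNat]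
  ring

theorem mon_mul_r4 (g : ℤ) (a b c d : ℕ) :
    mon a b c d * r4 g =
      (133 : ℚ) • mon (a + 4) b c d + (-537 : ℚ) • mon (a + 2) b (c + 1) d
      + (-798 * (g : ℚ) ^ 2 - 5415 * (g : ℚ) - 9170) • mon (a + 2) b c (d + 1)
      + (1074 * (g : ℚ) + 3636) • mon (a + 1) (b + 1) c (d + 1)
      + (-540 : ℚ) • mon a (b + 2) c (d + 1) + (540 : ℚ) • mon a b (c + 2) d
      + (537 * (g : ℚ) ^ 2 + 3636 * (g : ℚ) + 6144) • mon a b (c + 1) (d + 1)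
      + (133 * (g : ℚ) ^ 4 + 1805 * (g : ℚ) ^ 3 + 9170 * (g : ℚ) ^ 2 + 20680 * (g : ℚ)
        + 17472) • mon a b c (d + 2) := by
  simp only [r4, mon, smul_eq_C_mul, map_add, map_sub, map_neg, map_mul, map_pow, map_ofNat]
  ring

theorem mon_mul_r5 (g : ℤ) (a b c d : ℕ) :
    mon a b c d * r5 g =
      (-18545 * (g : ℚ) - 68407) • mon (a + 4) b c d + (15261 : ℚ) • mon (a + 3) (b + 1) c d
      + (45783 * (g : ℚ) + 175866) • mon (a + 2) b (c + 1) d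
      + (-31320 : ℚ) • mon (a + 1) (b + 1) (c + 1) d
      + (37090 * (g : ℚ) ^ 3 + 410442 * (g : ℚ) ^ 2 + 1499460 * (g : ℚ) + 1811300) • mon (a
        + 2) b c (d + 1)
      + (-45783 * (g : ℚ) ^ 2 - 351732 * (g : ℚ) - 662976) • mon (a + 1) (b + 1) c (d + 1)
      + (15660 * (g : ℚ) + 72360) • mon a (b + 2) c (d + 1)
      + (-15660 * (g : ℚ) - 72360) • mon a b (c + 2) d
      + (-15261 * (g : ℚ) ^ 3 - 175866 * (g : ℚ) ^ 2 - 662976 * (g : ℚ) - 822096) • mon a b (c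
        + 1) (d + 1)
      + (-3709 * (g : ℚ) ^ 5 - 68407 * (g : ℚ) ^ 4 - 499820 * (g : ℚ) ^ 3
        - 1811300 * (g : ℚ) ^ 2 - 3260256 * (g : ℚ) - 2334528) • mon a b c (d + 2) := by
  simp only [r5, mon, smul_eq_C_mul, map_add, map_sub, map_neg, map_mul, map_pow, map_ofNat]
  ring

theorem socle_mon_mul_r1 (g : ℤ) (a b c d : ℕ) :
    socle g (mon a b c d * r1 g) = 0 := by
  simp only [mon_mul_r1, map_add, map_smul, socle_mon, smul_eq_mul]
  by_cases hw : a + b + 2 * c + 2 * d = 3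
  · have hc : c ≤ 1 := by lia
    have hd : d ≤ 1 := by lia
    have ha : a ≤ 3 := by lia
    have hb : b = 3 - a - 2 * c - 2 * d := by lia
    interval_cases c <;> interval_cases d <;> interval_cases a <;> first
      | (exfalso; lia)
      | (subst hb; simp [socleTable]; ring)
  · repeat rw [if_neg (by lia)]
    ring

theorem socle_mon_mul_r2 (g : ℤ) (a b c d : ℕ) :
    socle g (mon a b c d * r2 g) = 0 := by
  simp only [mon_mul_r2, map_add, map_smul, socle_mon, smul_eq_mul]
  by_cases hw : a + b + 2 * c + 2 * d = 3
  · have hc : c ≤ 1 := by lia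
    have hd : d ≤ 1 := by lia
    have ha : a ≤ 3 := by lia
    have hb : b = 3 - a - 2 * c - 2 * d := by lia
    interval_cases c <;> interval_cases d <;> interval_cases a <;> first
      | (exfalso; lia)
      | (subst hb; simp [socleTable]; ring)
  · repeat rw [if_neg (by lia)]
    ring

theorem socle_mon_mul_r3 (g : ℤ) (a b c d : ℕ) :
    socle g (mon a b c d * r3 g) = 0 := by
  simp only [mon_mul_r3, map_add, map_smul, socle_mon, smul_eq_mul]
  by_cases hw : a + b + 2 * c + 2 * d = 2
  · have hc : c ≤ 1 := by lia
    have hd : d ≤ 1 := by lia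
    have ha : a ≤ 2 := by lia
    have hb : b = 2 - a - 2 * c - 2 * d := by lia
    interval_cases c <;> interval_cases d <;> interval_cases a <;> first
      | (exfalso; lia)
      | (subst hb; simp [socleTable]; ring)
  · repeat rw [if_neg (by lia)]
    ring

theorem socle_mon_mul_r4 (g : ℤ) (a b c d : ℕ) :
    socle g (mon a b c d * r4 g) = 0 := by
  simp only [mon_mul_r4, map_add, map_smul, socle_mon, smul_eq_mul]
  by_cases hw : a + b + 2 * c + 2 * d = 2
  · have hc : c ≤ 1 := by lia
    have hd : d ≤ 1 := by lia
    have ha : a ≤ 2 := by lia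
    have hb : b = 2 - a - 2 * c - 2 * d := by lia
    interval_cases c <;> interval_cases d <;> interval_cases a <;> first
      | (exfalso; lia)
      | (subst hb; simp [socleTable]; ring)
  · repeat rw [if_neg (by lia)]
    ring

theorem socle_mon_mul_r5 (g : ℤ) (a b c d : ℕ) :
    socle g (mon a b c d * r5 g) = 0 := by
  simp only [mon_mul_r5, map_add, map_smul, socle_mon, smul_eq_mul]
  by_cases hw : a + b + 2 * c + 2 * d = 2
  · have hc : c ≤ 1 := by lia
    have hd : d ≤ 1 := by lia
    have ha : a ≤ 2 := by lia
    have hb : b = 2 - a - 2 * c - 2 * d := by lia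
    interval_cases c <;> interval_cases d <;> interval_cases a <;> first
      | (exfalso; lia)
      | (subst hb; simp [socleTable]; ring)
  · repeat rw [if_neg (by lia)]
    ring

theorem socle_mul_eq_zero {g : ℤ} {p : P4} (hp : p ∈ Jg g) (t : P4) : socle g (t * p) = 0 := by
  have hgen (r : P4) (hr : ∀ a b c d, socle g (mon a b c d * r) = 0) (t : P4) :
      socle g (t * r) = 0 := by
    suffices socle g ∘ₗ LinearMap.mulRight ℚ r = 0 from LinearMap.congr_fun this t
    refine (basisMonomials (Fin 4) ℚ).ext fun s => ?_
    simp [monomial_eq_mon, hr]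
  induction hp using Submodule.span_induction generalizing t with
  | mem r hr =>
    refine hgen r ?_ t
    rcases hr with rfl | rfl | rfl | rfl | rfl
    exacts [socle_mon_mul_r1 g, socle_mon_mul_r2 g, socle_mon_mul_r3 g, socle_mon_mul_r4 g,
      socle_mon_mul_r5 g]
  | zero => simp
  | add p p' _ _ hp hp' => rw [mul_add, map_add, hp, hp', add_zero]
  | smul u p _ hp => rw [smul_eq_mul, ← mul_assoc, hp]
theorem Smk_eq_zero_iff {g : ℤ} {p : P4} : Smk g p = 0 ↔ p ∈ Jg g :=
  Ideal.Quotient.eq_zero_iff_mem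

theorem Smk_mon (g : ℤ) (a b c d : ℕ) :
    Smk g (mon a b c d) = Smk g a1 ^ a * Smk g a2' ^ b * Smk g a2 ^ c * Smk g c2 ^ d := by
  simp [Smk, mon]

theorem SComp_le {g : ℤ} {n : ℕ} {S : Submodule ℚ (P4 ⧸ Jg g)}
    (hS : ∀ a b c d, a + b + 2 * c + 2 * d = n → Smk g (mon a b c d) ∈ S) : SComp g n ≤ S := by
  rintro _ ⟨p, hp, rfl⟩
  rw [← p.support_sum_monomial_coeff, map_sum]
  refine Submodule.sum_mem _ fun s hs => ?_
  have hw := (mem_weightedHomogeneousSubmodule ℚ wt n p).1 hp (mem_support_iff.1 hs)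
  rw [weight_eq] at hw
  rw [← mul_one (coeff s p), ← smul_eq_mul, ← smul_monomial, map_smul, monomial_eq_mon]
  exact S.smul_mem _ (hS _ _ _ _ hw)

theorem eq_zero_of_add_mem_Jg {g : ℤ} {n : ℕ} {α β : ℚ} {v : P4} (hv : dualEval v = 0)
    (h : α • mon 0 (n + 1) 0 0 + (β • mon 1 n 0 0 + v) ∈ Jg g) : α = 0 ∧ β = 0 := by
  have h := dualEval_eq_zero h
  simp only [map_add, map_smul, dualEval_mon, hv, pow_zero, pow_one, mul_one, add_zero] at h
  refine ⟨?_, ?_⟩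
  · simpa using congrArg TrivSqZeroExt.fst h
  · simpa using congrArg TrivSqZeroExt.snd h

theorem finrank_SComp_succ {g : ℤ} (hg : 0 < g) {n k : ℕ} (b : Fin k → P4)
    (hhom : ∀ j, IsWeightedHomogeneous wt (b j) (n + 1)) (hdual : ∀ j, dualEval (b j) = 0)
    (hspan : idealPart (Smk g a1) (Smk g a2') (Smk g a2) (Smk g c2) (n + 1) ≤
      Submodule.span ℚ (Set.range (Smk g ∘ b)))
    (hind : ∀ c : Fin k → ℚ, ∑ j, c j • b j ∈ Jg g → ∀ j, c j = 0) :
    Module.finrank ℚ (SComp g (n + 1)) = k + 2 := by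
  set B : Fin (k + 2) → P4 := Matrix.vecCons (mon 0 (n + 1) 0 0) (Matrix.vecCons (mon 1 n 0 0) b)
    with hB
  have hli : LinearIndependent ℚ (Smk g ∘ B) := by
    refine Fintype.linearIndependent_iff.2 fun c hc => ?_
    simp only [Function.comp_apply, ← map_smul, ← map_sum] at hc
    rw [Smk_eq_zero_iff, Fin.sum_univ_succ, Fin.sum_univ_succ] at hc
    simp only [hB, Matrix.cons_val_zero, Matrix.cons_val_succ] at hc
    obtain ⟨h0, h1⟩ := eq_zero_of_add_mem_Jg (by simp [hdual]) hc
    rw [h0, h1, zero_smul, zero_smul, zero_add, zero_add] at hc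
    exact Fin.cases h0 (Fin.cases h1 (hind _ hc))
  have hspanB : SComp g (n + 1) = Submodule.span ℚ (Set.range (Smk g ∘ B)) := by
    refine le_antisymm (SComp_le fun e f e' f' hw => ?_) (Submodule.span_le.2 ?_)
    · rw [Smk_mon]
      refine (sup_le (Submodule.span_le.2 ?_) (hspan.trans (Submodule.span_mono ?_)))
        ((relations_mk g).monomial_mem (by exact_mod_cast hg) e f e' f' hw)
      · rintro _ (rfl | rfl)
        · exact Submodule.subset_span ⟨0, by simp [hB, Smk_mon]⟩
        · exact Submodule.subset_span ⟨1, by simp [hB, Smk_mon]⟩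
      · rintro _ ⟨j, rfl⟩
        exact ⟨j.succ.succ, rfl⟩
    · rintro _ ⟨j, rfl⟩
      refine ⟨B j, (mem_weightedHomogeneousSubmodule ℚ wt _ _).2 ?_, rfl⟩
      refine Fin.cases ?_ (Fin.cases ?_ hhom) j
      · exact isWeightedHomogeneous_mon (by lia)
      · exact isWeightedHomogeneous_mon (by lia)
  rw [hspanB, finrank_span_eq_card hli, Fintype.card_fin]

theorem coeffs_eq_zero_two {g : ℤ} (hg : 0 < (g : ℚ)) {α₀ α₁ α₂ : ℚ}
    (h : α₀ • mon 2 0 0 0 + α₁ • mon 0 0 1 0 + α₂ • mon 0 0 0 1 ∈ Jg g) :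
    α₀ = 0 ∧ α₁ = 0 ∧ α₂ = 0 := by
  have h₀ := socle_mul_eq_zero h (mon 2 0 0 1)
  have h₁ := socle_mul_eq_zero h (mon 0 0 0 2)
  have h₂ := socle_mul_eq_zero h (mon 0 0 1 1)
  simp only [mul_add, mul_smul_comm, mon_mul_mon, map_add, map_smul, socle_mon, smul_eq_mul,
    Nat.reduceAdd, Nat.reduceMul, if_true, socleTable] at h₀ h₁ h₂
  generalize (g : ℚ) = q at hg h₀ h₁ h₂
  refine ⟨?_, ?_, ?_⟩
  · refine mul_left_cancel₀ (show 4 * (q + 4) * q * (2 * q + 7) * (2 * q + 1) ≠ 0 by positivity) ?_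
    linear_combination
      (-16464 * q - 7987) * h₀ + (16464 * q ^ 3 + 123445 * q ^ 2 + 255052 * q + 98784) * h₁
      + (35280 * q + 17640) * h₂
  · refine mul_left_cancel₀ (show (q + 4) * q * (2 * q + 7) ≠ 0 by positivity) ?_
    linear_combination
      (4410) * h₀ + (-4410 * q ^ 2 - 30870 * q - 52920) * h₁ + (-9450) * h₂
  · refine mul_left_cancel₀ (show 4 * q * (2 * q + 7) * (2 * q + 1) ≠ 0 by positivity) ?_
    linear_combination
      (16464 * q ^ 2 + 57589 * q + 24696) * h₀
      + (-16464 * q ^ 4 - 172851 * q ^ 3 - 625548 * q ^ 2 - 864332 * q - 296352) * h₁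
      + (-35280 * q ^ 2 - 123480 * q - 52920) * h₂

theorem coeffs_eq_zero_three {g : ℤ} (hg : 0 < (g : ℚ)) {α₀ α₁ α₂ α₃ : ℚ}
    (h : α₀ • mon 3 0 0 0 + α₁ • mon 0 1 0 1 + α₂ • mon 1 0 0 1 + α₃ • mon 1 0 1 0 ∈ Jg g) :
    α₀ = 0 ∧ α₁ = 0 ∧ α₂ = 0 ∧ α₃ = 0 := by
  have h₀ := socle_mul_eq_zero h (mon 3 0 0 0)
  have h₁ := socle_mul_eq_zero h (mon 0 1 0 1)
  have h₂ := socle_mul_eq_zero h (mon 1 0 0 1)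
  have h₃ := socle_mul_eq_zero h (mon 1 0 1 0)
  simp only [mul_add, mul_smul_comm, mon_mul_mon, map_add, map_smul, socle_mon, smul_eq_mul,
    Nat.reduceAdd, Nat.reduceMul, if_true, socleTable] at h₀ h₁ h₂ h₃
  generalize (g : ℚ) = q at hg h₀ h₁ h₂ h₃
  refine ⟨?_, ?_, ?_, ?_⟩
  · refine mul_left_cancel₀ (show 4 * (q + 4) * (q + 3) * (q + 1) * q * (2 * q + 7) * (2 * q
        + 1) ≠ 0 by positivity) ?_
    linear_combination
      (-102900 * q - 102725) * h₀ + (-132300 * q ^ 2 - 308700 * q - 176400) * h₁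
      + (226380 * q ^ 3 + 1543395 * q ^ 2 + 3127740 * q + 1810900) * h₂
      + (220500 * q + 220500) * h₃
  · refine mul_left_cancel₀ (show (q + 4) * (q + 3) * q * (2 * q + 7) * (2 * q
        + 1) ≠ 0 by positivity) ?_
    linear_combination
      (-33075 * q - 44100) * h₀ + (-23625 * q ^ 2 - 47250 * q - 47250) * h₁
      + (55125 * q ^ 3 + 396900 * q ^ 2 + 904050 * q + 683550) * h₂ + (70875 * q + 94500) * h₃
  · refine mul_left_cancel₀ (show 4 * (q + 4) * (q + 3) * (q + 1) * q * (2 * q + 7) * (2 * q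
        + 1) ≠ 0 by positivity) ?_
    linear_combination
      (226380 * q ^ 3 + 1543395 * q ^ 2 + 3127740 * q + 1810900) * h₀
      + (220500 * q ^ 4 + 1808100 * q ^ 3 + 5203800 * q ^ 2 + 6350400 * q + 2734200) * h₁
      + (-432180 * q ^ 5 - 5535845 * q ^ 4 - 27411160 * q ^ 3 - 65152780 * q ^ 2 - 73508960 * q
        - 30663500) * h₂
      + (-485100 * q ^ 3 - 3307500 * q ^ 2 - 6703200 * q - 3880800) * h₃
  · refine mul_left_cancel₀ (show (q + 4) * (q + 3) * q * (2 * q + 7) * (2 * q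
        + 1) ≠ 0 by positivity) ?_
    linear_combination
      (55125) * h₀ + (70875 * q + 94500) * h₁ + (-121275 * q ^ 2 - 705600 * q - 970200) * h₂
      + (-118125) * h₃

theorem coeffs_eq_zero_four {g : ℤ} (hg : 0 < (g : ℚ)) {α₀ α₁ α₂ α₃ α₄ : ℚ}
    (h : α₀ • mon 2 0 0 1 + α₁ • mon 0 0 0 2 + α₂ • mon 2 0 1 0 + α₃ • mon 0 0 1 1
      + α₄ • mon 0 0 2 0 ∈ Jg g) :
    α₀ = 0 ∧ α₁ = 0 ∧ α₂ = 0 ∧ α₃ = 0 ∧ α₄ = 0 := by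
  have h₀ := socle_mul_eq_zero h (mon 0 2 0 0)
  have h₁ := socle_mul_eq_zero h (mon 1 1 0 0)
  have h₂ := socle_mul_eq_zero h (mon 2 0 0 0)
  have h₃ := socle_mul_eq_zero h (mon 0 0 0 1)
  have h₄ := socle_mul_eq_zero h (mon 0 0 1 0)
  simp only [mul_add, mul_smul_comm, mon_mul_mon, map_add, map_smul, socle_mon, smul_eq_mul,
    Nat.reduceAdd, Nat.reduceMul, if_true, socleTable] at h₀ h₁ h₂ h₃ h₄
  generalize (g : ℚ) = q at hg h₀ h₁ h₂ h₃ h₄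
  refine ⟨?_, ?_, ?_, ?_, ?_⟩
  · refine mul_left_cancel₀ (show 32 * (q + 4) * (q + 3) * q * (2 * q + 7) * (2 * q
        + 5) * (2 * q + 3) * (2 * q + 1) ≠ 0 by positivity) ?_
    linear_combination
      (-2677374000 * q ^ 2 - 12485907000 * q - 12680955000) * h₀
      + (4993531200 * q ^ 3 + 40805991450 * q ^ 2 + 105360694425 * q + 83012792625) * h₁
      + (-2327680320 * q ^ 4 - 27206553290 * q ^ 3 - 115994289215 * q ^ 2 - 211380693300 * q
        - 136077109875) * h₂
      + (-658560 * q ^ 6 + 4816910 * q ^ 5 + 153376825 * q ^ 4 + 1026484130 * q ^ 3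
        + 3056819745 * q ^ 2 + 4279391550 * q + 2268945000) * h₃
      + (-1411200 * q ^ 4 + 18077850 * q ^ 3 + 194296725 * q ^ 2 + 517773375 * q + 405168750) * h₄
  · refine mul_left_cancel₀ (show 32 * q * (2 * q + 7) * (2 * q + 5) * (2 * q + 3) * (2 * q
        + 1) ≠ 0 by positivity) ?_
    linear_combination
      (355622400 * q ^ 3 + 3561742800 * q ^ 2 + 9896909400 * q + 8033256000) * h₀
      + (-663828480 * q ^ 4 - 8973538560 * q ^ 3 - 41768320230 * q ^ 2 - 79730990325 * q
        - 52547355000) * h₁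
      + (309786624 * q ^ 5 + 5274538752 * q ^ 4 + 34187598326 * q ^ 3 + 105615046943 * q ^ 2
        + 155103436215 * q + 86057533800) * h₂
      + (-1646400 * q ^ 6 - 33148402 * q ^ 5 - 265603121 * q ^ 4 - 1089944163 * q ^ 3
        - 2423211014 * q ^ 2 - 2769600120 * q - 1269374400) * h₃
      + (-3245760 * q ^ 4 - 43510950 * q ^ 3 - 194606265 * q ^ 2 - 355969950 * q - 226674000) * h₄
  · refine mul_left_cancel₀ (show 32 * (q + 4) * (q + 3) * q * (2 * q + 7) * (2 * q
        + 5) * (2 * q + 3) * (2 * q + 1) ≠ 0 by positivity) ?_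
    linear_combination
      (-1905120000 * q - 2849175000) * h₀
      + (3556224000 * q ^ 2 + 17788680000 * q + 18657253125) * h₁
      + (-1659571200 * q ^ 3 - 14132462400 * q ^ 2 - 37871736525 * q - 30594540375) * h₂
      + (10231200 * q ^ 4 + 116564175 * q ^ 3 + 481384575 * q ^ 2 + 847277550 * q + 527877000) * h₃
      + (20412000 * q ^ 2 + 94051125 * q + 94263750) * h₄
  · refine mul_left_cancel₀ (show 32 * (q + 4) * (q + 3) * q * (2 * q + 7) * (2 * q
        + 5) * (2 * q + 3) * (2 * q + 1) ≠ 0 by positivity) ?_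
    linear_combination
      (1905120000 * q ^ 3 + 16202025000 * q ^ 2 + 42921900000 * q + 34360200000) * h₀
      + (-3556224000 * q ^ 4 - 42704928000 * q ^ 3 - 186102322875 * q ^ 2 - 344909218500 * q
        - 224765415000) * h₁
      + (1659571200 * q ^ 5 + 25754400000 * q ^ 4 + 156799069875 * q ^ 3 + 465779026125 * q ^ 2
        + 669794271300 * q + 368110197000) * h₂
      + (-8820000 * q ^ 6 - 161442225 * q ^ 5 - 1212826125 * q ^ 4 - 4778187750 * q ^ 3
        - 10385655000 * q ^ 2 - 11761772400 * q - 5387256000) * h₃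
      + (-17388000 * q ^ 4 - 200788875 * q ^ 3 - 842514750 * q ^ 2 - 1511874000 * q
        - 962010000) * h₄
  · refine mul_left_cancel₀ (show 4 * (q + 4) * (q + 3) * q * (2 * q + 7) * (2 * q + 5) * (2 * q
        + 1) ≠ 0 by positivity) ?_
    linear_combination
      (127575000) * h₀ + (-238140000 * q - 834553125) * h₁
      + (111132000 * q ^ 2 + 779554125 * q + 1366824375) * h₂
      + (-543375 * q ^ 3 - 5457375 * q ^ 2 - 18096750 * q - 19845000) * h₃
      + (-1063125 * q - 3543750) * h₄

theorem coeffs_eq_zero_five {g : ℤ} (hg : 0 < (g : ℚ)) {α₀ α₁ : ℚ}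
    (h : α₀ • mon 1 0 0 2 + α₁ • mon 1 0 1 1 ∈ Jg g) :
    α₀ = 0 ∧ α₁ = 0 := by
  have h₀ := socle_mul_eq_zero h (mon 0 1 0 0)
  have h₁ := socle_mul_eq_zero h (mon 1 0 0 0)
  simp only [mul_add, mul_smul_comm, mon_mul_mon, map_add, map_smul, socle_mon, smul_eq_mul,
    Nat.reduceAdd, Nat.reduceMul, if_true, socleTable] at h₀ h₁
  generalize (g : ℚ) = q at hg h₀ h₁
  refine ⟨?_, ?_⟩
  · refine mul_left_cancel₀ (show (q + 4) * q * (3 * q + 4) ≠ 0 by positivity) ?_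
    linear_combination
      (4410 * q + 35280) * h₀ + (-4116 * q ^ 2 - 47313 * q - 115220) * h₁
  · refine mul_left_cancel₀ (show (q + 4) * q * (2 * q + 7) * (3 * q + 4) ≠ 0 by positivity) ?_
    linear_combination
      (47250) * h₀ + (-44100 * q - 154350) * h₁

theorem coeffs_eq_zero_six {g : ℤ} {α : ℚ}
    (h : α • mon 0 0 0 3 ∈ Jg g) :
    α = 0 := by
  have h₀ := socle_mul_eq_zero h (mon 0 0 0 0)
  simp only [mul_smul_comm, mon_mul_mon, map_smul, socle_mon, smul_eq_mul,
    Nat.reduceAdd, Nat.reduceMul, if_true, socleTable] at h₀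
  linear_combination h₀

theorem finrank_SComp_two {g : ℤ} (hg : 0 < g) :
    Module.finrank ℚ (SComp g 2) = 5 := by
  refine finrank_SComp_succ hg ![mon 2 0 0 0, mon 0 0 1 0, mon 0 0 0 1] ?_ ?_ ?_ ?_
  · intro j
    fin_cases j <;> exact isWeightedHomogeneous_mon rfl
  · intro j
    fin_cases j <;> simp [dualEval_mon, pow_succ]
  · refine Submodule.span_mono ?_
    simp only [Set.insert_subset_iff, Set.singleton_subset_iff]
    exact ⟨⟨0, by simp [Smk_mon]⟩, ⟨1, by simp [Smk_mon]⟩, ⟨2, by simp [Smk_mon]⟩⟩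
  · intro c hc
    simp only [Fin.sum_univ_three, Matrix.cons_val] at hc
    obtain ⟨h₀, h₁, h₂⟩ := coeffs_eq_zero_two (by exact_mod_cast hg) hc
    intro j
    fin_cases j
    exacts [h₀, h₁, h₂]

theorem finrank_SComp_three {g : ℤ} (hg : 0 < g) :
    Module.finrank ℚ (SComp g 3) = 6 := by
  refine finrank_SComp_succ hg ![mon 3 0 0 0, mon 0 1 0 1, mon 1 0 0 1, mon 1 0 1 0] ?_ ?_ ?_ ?_
  · intro j
    fin_cases j <;> exact isWeightedHomogeneous_mon rfl
  · intro j
    fin_cases j <;> simp [dualEval_mon, pow_succ]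
  · refine Submodule.span_mono ?_
    simp only [Set.insert_subset_iff, Set.singleton_subset_iff]
    exact ⟨⟨0, by simp [Smk_mon]⟩, ⟨1, by simp [Smk_mon]⟩, ⟨2, by simp [Smk_mon]⟩, ⟨3,
      by simp [Smk_mon]⟩⟩
  · intro c hc
    simp only [Fin.sum_univ_four, Matrix.cons_val] at hc
    obtain ⟨h₀, h₁, h₂, h₃⟩ := coeffs_eq_zero_three (by exact_mod_cast hg) hc
    intro j
    fin_cases j
    exacts [h₀, h₁, h₂, h₃]

theorem finrank_SComp_four {g : ℤ} (hg : 0 < g) :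
    Module.finrank ℚ (SComp g 4) = 7 := by
  refine finrank_SComp_succ hg ![mon 2 0 0 1, mon 0 0 0 2, mon 2 0 1 0, mon 0 0 1 1,
      mon 0 0 2 0] ?_ ?_ ?_ ?_
  · intro j
    fin_cases j <;> exact isWeightedHomogeneous_mon rfl
  · intro j
    fin_cases j <;> simp [dualEval_mon, pow_succ]
  · refine Submodule.span_mono ?_
    simp only [Set.insert_subset_iff, Set.singleton_subset_iff]
    exact ⟨⟨0, by simp [Smk_mon]⟩, ⟨1, by simp [Smk_mon]⟩, ⟨2, by simp [Smk_mon]⟩, ⟨3,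
      by simp [Smk_mon]⟩, ⟨4, by simp [Smk_mon]⟩⟩
  · intro c hc
    simp only [Fin.sum_univ_five, Matrix.cons_val] at hc
    obtain ⟨h₀, h₁, h₂, h₃, h₄⟩ := coeffs_eq_zero_four (by exact_mod_cast hg) hc
    intro j
    fin_cases j
    exacts [h₀, h₁, h₂, h₃, h₄]

theorem finrank_SComp_five {g : ℤ} (hg : 0 < g) :
    Module.finrank ℚ (SComp g 5) = 4 := by
  refine finrank_SComp_succ hg ![mon 1 0 0 2, mon 1 0 1 1] ?_ ?_ ?_ ?_
  · intro j
    fin_cases j <;> exact isWeightedHomogeneous_mon rfl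
  · intro j
    fin_cases j <;> simp [dualEval_mon, pow_succ]
  · refine Submodule.span_mono ?_
    simp only [Set.insert_subset_iff, Set.singleton_subset_iff]
    exact ⟨⟨0, by simp [Smk_mon]⟩, ⟨1, by simp [Smk_mon]⟩⟩
  · intro c hc
    simp only [Fin.sum_univ_two, Matrix.cons_val] at hc
    obtain ⟨h₀, h₁⟩ := coeffs_eq_zero_five (by exact_mod_cast hg) hc
    intro j
    fin_cases j
    exacts [h₀, h₁]

theorem finrank_SComp_six {g : ℤ} (hg : 0 < g) :
    Module.finrank ℚ (SComp g 6) = 3 := by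
  refine finrank_SComp_succ hg ![mon 0 0 0 3] ?_ ?_ ?_ ?_
  · intro j
    fin_cases j
    exact isWeightedHomogeneous_mon rfl
  · intro j
    fin_cases j
    simp [dualEval_mon, pow_succ]
  · refine Submodule.span_mono ?_
    simp only [Set.singleton_subset_iff]
    exact ⟨0, by simp [Smk_mon]⟩
  · intro c hc
    simp only [Fin.sum_univ_one, Matrix.cons_val] at hc
    have h₀ := coeffs_eq_zero_six hc
    intro j
    fin_cases j
    exacts [h₀]

theorem finrank_SComp_of_idealPart_eq_bot {g : ℤ} (hg : 0 < g) {n : ℕ}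
    (hn : ∀ x y z w : P4 ⧸ Jg g, idealPart x y z w (n + 1) = ⊥) :
    Module.finrank ℚ (SComp g (n + 1)) = 2 :=
  finrank_SComp_succ hg ![] (fun j => j.elim0) (fun j => j.elim0) (by simp [hn])
    fun _ _ j => j.elim0

/-- Dimensions of the stable Chow groups of the degree-5 Hurwitz space:
for `i ≥ 1` and `g > 5i + 76`, `dim_ℚ S(g)_i` is `2, 5, 6, 7, 4, 3` for
`i = 1, ..., 6` and `2` for `i ≥ 7`. -/
theorem dim_SComp (i : ℕ) (hi : 1 ≤ i) (g : ℤ) (hg : g > 5 * (i : ℤ) + 76) :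
    Module.finrank ℚ (SComp g i) =
      if i = 1 then 2 else if i = 2 then 5 else if i = 3 then 6 else if i = 4 then 7
        else if i = 5 then 4 else if i = 6 then 3 else 2 := by
  have hg0 : 0 < g := by lia
  match i, hi with
  | 1, _ => simpa using finrank_SComp_of_idealPart_eq_bot hg0 (n := 0) fun _ _ _ _ => rfl
  | 2, _ => simpa using finrank_SComp_two hg0
  | 3, _ => simpa using finrank_SComp_three hg0
  | 4, _ => simpa using finrank_SComp_four hg0
  | 5, _ => simpa using finrank_SComp_five hg0
  | 6, _ => simpa using finrank_SComp_six hg0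
  | n + 7, _ =>
    simpa using finrank_SComp_of_idealPart_eq_bot hg0 (n := n + 6) fun _ _ _ _ => rfl
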